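/- arXiv:1901.07136 — 5 statements merged into one kernel-verified Lean document; each statement's English description precedes it below -/
import Mathlib

section
/- For a cellular two-sender index coding instance (G,M,R) over F_2 in which k ∈ M_i and X_k ⊆ M_i for every k ∈ R(s_i), i = 1,2, the optimal codelength satisfies N_opt^2(G,M,R) = min_F ( dim(V_1 + V_2 + V_3) + dim(V_1 ∩ V_2) ), where the minimum is over all cellular fitting matrices F for the (G,M,R)-IC. -/
open Matrix BigOperators


/-- A linear index code of total length `N` for the cellular two-sender instance over `F_2`:
receivers indexed in `R1` (resp. `R2`) receive only the sub-codeword of sender 1 (resp. 2),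
receivers indexed in `Rc` receive both sub-codewords; receiver `k` demands `x k` and has
side information `X k`. -/
def IsCellIC (n : ℕ) (M1 M2 R1 R2 Rc : Finset (Fin n)) (X : Fin n → Finset (Fin n))
    (N : ℕ) : Prop :=
  ∃ (N1 N2 : ℕ) (G1 : Matrix (Fin n) (Fin N1) (ZMod 2)) (G2 : Matrix (Fin n) (Fin N2) (ZMod 2)),
    N = N1 + N2 ∧
    (∀ r : Fin n, r ∉ M1 → ∀ t, G1 r t = 0) ∧
    (∀ r : Fin n, r ∉ M2 → ∀ t, G2 r t = 0) ∧
    (∀ k ∈ R1, ∃ D : (Fin N1 → ZMod 2) → ({j : Fin n // j ∈ X k} → ZMod 2) → ZMod 2,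
      ∀ x : Fin n → ZMod 2, D (fun t => ∑ r, x r * G1 r t) (fun j => x j.val) = x k) ∧
    (∀ k ∈ R2, ∃ D : (Fin N2 → ZMod 2) → ({j : Fin n // j ∈ X k} → ZMod 2) → ZMod 2,
      ∀ x : Fin n → ZMod 2, D (fun t => ∑ r, x r * G2 r t) (fun j => x j.val) = x k) ∧
    (∀ k ∈ Rc, ∃ D : (Fin N1 → ZMod 2) → (Fin N2 → ZMod 2) →
        ({j : Fin n // j ∈ X k} → ZMod 2) → ZMod 2,
      ∀ x : Fin n → ZMod 2,
        D (fun t => ∑ r, x r * G1 r t) (fun t => ∑ r, x r * G2 r t) (fun j => x j.val) = x k)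

/-- The optimal codelength `N_opt^2(G,M,R)` of the cellular two-sender instance. -/
noncomputable def NOptCell (n : ℕ) (M1 M2 R1 R2 Rc : Finset (Fin n))
    (X : Fin n → Finset (Fin n)) : ℕ :=
  sInf {N | IsCellIC n M1 M2 R1 R2 Rc X N}

/-- A cellular fitting matrix, given by its columns: one column `F1 k` (resp. `F2 k`) for
each receiver `k ∈ R1` (resp. `k ∈ R2`), equal to `e_k + Σ_{j ∈ X k} c_j e_j`, and two
columns `F3 k 0`, `F3 k 1` for each `k ∈ Rc`, supported in `M1` resp. `M2`, whose sum is
`e_k + Σ_{j ∈ X k} c_j e_j`. -/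
def IsCellFitting (n : ℕ) (M1 M2 R1 R2 Rc : Finset (Fin n)) (X : Fin n → Finset (Fin n))
    (F1 : {k : Fin n // k ∈ R1} → Fin n → ZMod 2)
    (F2 : {k : Fin n // k ∈ R2} → Fin n → ZMod 2)
    (F3 : {k : Fin n // k ∈ Rc} → Fin 2 → Fin n → ZMod 2) : Prop :=
  (∀ k : {k : Fin n // k ∈ R1}, F1 k k.val = 1 ∧
    ∀ i : Fin n, i ≠ k.val → i ∉ X k.val → F1 k i = 0) ∧
  (∀ k : {k : Fin n // k ∈ R2}, F2 k k.val = 1 ∧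
    ∀ i : Fin n, i ≠ k.val → i ∉ X k.val → F2 k i = 0) ∧
  (∀ k : {k : Fin n // k ∈ Rc},
    (∀ i : Fin n, i ∉ M1 → F3 k 0 i = 0) ∧
    (∀ i : Fin n, i ∉ M2 → F3 k 1 i = 0) ∧
    F3 k 0 k.val + F3 k 1 k.val = 1 ∧
    (∀ i : Fin n, i ≠ k.val → i ∉ X k.val → F3 k 0 i + F3 k 1 i = 0))

/-- The span of a family of column vectors in `F_2^n`. -/
def spanOf (n : ℕ) {α : Type} (g : α → Fin n → ZMod 2) :
    Submodule (ZMod 2) (Fin n → ZMod 2) :=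
  Submodule.span (ZMod 2) (Set.range g)


open Module in
/-- Relative to a subspace `P`, any subspace `A` contains a subspace `D` that is independent of
`P` and generates `P ⊔ A` together with `P`. -/
lemma exists_le_sup_eq_finrank {K V : Type*} [Field K] [AddCommGroup V] [Module K V]
    [FiniteDimensional K V] (P A : Submodule K V) :
    ∃ D ≤ A, P ⊔ D = P ⊔ A ∧ finrank K P + finrank K D = finrank K ↥(P ⊔ A) := by
  obtain ⟨E, hE⟩ := exists_isCompl (P ⊓ A)
  have hA : (P ⊓ A) ⊔ E ⊓ A = A := by
    rw [← sup_inf_assoc_of_le E (inf_le_right : P ⊓ A ≤ A), hE.sup_eq_top, top_inf_eq]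
  have hsup : P ⊔ E ⊓ A = P ⊔ A := by
    refine le_antisymm (sup_le_sup_left inf_le_right _) (sup_le le_sup_left ?_)
    calc A = (P ⊓ A) ⊔ E ⊓ A := hA.symm
      _ ≤ P ⊔ E ⊓ A := sup_le_sup_right inf_le_left _
  refine ⟨E ⊓ A, inf_le_right, hsup, ?_⟩
  have hinf : P ⊓ (E ⊓ A) = ⊥ := by
    rw [← hE.inf_eq_bot]
    ac_rfl
  have h := Submodule.finrank_sup_add_finrank_inf_eq P (E ⊓ A)
  rw [hinf, finrank_bot, hsup] at h
  omega

open Module in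
/-- If `V₁ ≤ A` and `V₂ ≤ B`, then `V₁` and `V₂` can be enlarged inside `A` and `B` so as to
generate `A ⊔ B`, without enlarging their intersection (as measured by dimensions). -/
lemma exists_intermediate_sup_eq {K V : Type*} [Field K] [AddCommGroup V] [Module K V]
    [FiniteDimensional K V] {V₁ V₂ A B : Submodule K V} (h₁ : V₁ ≤ A) (h₂ : V₂ ≤ B) :
    ∃ C₁ C₂ : Submodule K V, V₁ ≤ C₁ ∧ C₁ ≤ A ∧ V₂ ≤ C₂ ∧ C₂ ≤ B ∧ C₁ ⊔ C₂ = A ⊔ B ∧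
      finrank K C₁ + finrank K C₂ ≤ finrank K ↥(A ⊔ B) + finrank K ↥(V₁ ⊓ V₂) := by
  obtain ⟨D₁, hD₁, hs₁, hf₁⟩ := exists_le_sup_eq_finrank (V₁ ⊔ V₂) A
  obtain ⟨D₂, hD₂, hs₂, hf₂⟩ := exists_le_sup_eq_finrank (V₁ ⊔ V₂ ⊔ A) B
  have htot : V₁ ⊔ V₂ ⊔ A ⊔ B = A ⊔ B :=
    le_antisymm (sup_le (sup_le (sup_le (h₁.trans le_sup_left) (h₂.trans le_sup_right))
      le_sup_left) le_sup_right) (sup_le_sup_right le_sup_right _)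
  refine ⟨V₁ ⊔ D₁, V₂ ⊔ D₂, le_sup_left, sup_le h₁ hD₁, le_sup_left, sup_le h₂ hD₂, ?_, ?_⟩
  · rw [← htot, ← hs₂, ← hs₁]
    ac_rfl
  · have e₁ := Submodule.finrank_add_le_finrank_add_finrank V₁ D₁
    have e₂ := Submodule.finrank_add_le_finrank_add_finrank V₂ D₂
    have e₃ := Submodule.finrank_sup_add_finrank_inf_eq V₁ V₂
    rw [htot] at hf₂
    omega

/-- The subspace of vectors supported in `S`. -/
def supportedIn (K : Type*) [Field K] {ι : Type*} (S : Finset ι) : Submodule K (ι → K) where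
  carrier := {y | ∀ i ∉ S, y i = 0}
  add_mem' := fun ha hb i hi => by simp [ha i hi, hb i hi]
  zero_mem' := fun _ _ => rfl
  smul_mem' := fun c _ ha i hi => by simp [ha i hi]

/-- `C` contains a vector of the form `e_k + ∑_{j ∈ X} c_j e_j` iff every `x` orthogonal to `C`
and vanishing on `X` vanishes at `k`. -/
lemma exists_mem_fitting_iff {K ι : Type*} [Field K] [Fintype ι]
    (C : Submodule K (ι → K)) {k : ι} {X : Finset ι} (hk : k ∉ X) :
    (∃ c ∈ C, c k = 1 ∧ ∀ i, i ≠ k → i ∉ X → c i = 0) ↔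
      ∀ x : ι → K, (∀ c ∈ C, x ⬝ᵥ c = 0) → (∀ j ∈ X, x j = 0) → x k = 0 := by
  classical
  constructor
  · rintro ⟨c, hc, hck, hci⟩ x hx hxX
    have h := hx c hc
    rw [dotProduct, Finset.sum_eq_single k, hck, mul_one] at h
    · exact h
    · intro i _ hik
      by_cases hi : i ∈ X
      · rw [hxX i hi, zero_mul]
      · rw [hci i hik hi, mul_zero]
    · simp
  · intro h
    have hmem : (Pi.single k 1 : ι → K) ∈ C ⊔ supportedIn K X := by
      by_contra hnot
      obtain ⟨f, hf, hle⟩ := Submodule.exists_le_ker_of_notMem hnot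
      have hfx : ∀ y : ι → K, (fun i => f (Pi.single i 1)) ⬝ᵥ y = f y := by
        intro y
        conv_rhs => rw [LinearMap.pi_apply_eq_sum_univ f y]
        simp only [dotProduct, smul_eq_mul]
        refine Finset.sum_congr rfl fun i _ => ?_
        rw [mul_comm]
        congr 2
        ext j
        simp [Pi.single_apply, eq_comm]
      refine hf (h (fun i => f (Pi.single i 1)) (fun c hc => ?_) fun j hj => ?_)
      · rw [hfx]
        exact hle (Submodule.mem_sup_left hc)
      · refine hle (Submodule.mem_sup_right fun i hi => ?_)
        exact Pi.single_eq_of_ne (fun e : i = j => hi (e ▸ hj)) 1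
    obtain ⟨c, hc, y, hy, hcy⟩ := Submodule.mem_sup.1 hmem
    refine ⟨c, hc, ?_, fun i hik hi => ?_⟩
    · have := congrFun hcy k
      simpa [hy k hk] using this
    · have := congrFun hcy i
      simpa [hy i hi, hik] using this

/-- Recovering `x k` from a linear observation `L x` and the side information `x|_X` is possible
iff the row space `C` of the observation contains a vector `e_k + ∑_{j ∈ X} c_j e_j`. -/
lemma exists_decoder_iff {K ι E : Type*} [Field K] [Fintype ι] [AddCommGroup E] [Module K E]
    (L : (ι → K) →ₗ[K] E) (C : Submodule K (ι → K))
    (hL : ∀ x, L x = 0 ↔ ∀ c ∈ C, x ⬝ᵥ c = 0) {k : ι} {X : Finset ι} (hk : k ∉ X) :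
    (∃ D : E → ({j // j ∈ X} → K) → K, ∀ x : ι → K, D (L x) (fun j => x j.val) = x k) ↔
      ∃ c ∈ C, c k = 1 ∧ ∀ i, i ≠ k → i ∉ X → c i = 0 := by
  rw [exists_mem_fitting_iff C hk]
  constructor
  · rintro ⟨D, hD⟩ x hx hxX
    have h0 := hD 0
    rw [← hD x, (hL x).2 hx, ← map_zero L]
    rw [Pi.zero_apply] at h0
    rw [← h0]
    congr 1
    ext j
    exact hxX j.1 j.2
  · intro h
    have hf : Function.FactorsThrough (fun x : ι → K => x k)
        (fun x : ι → K => (L x, fun j : {j // j ∈ X} => x j.val)) := by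
      intro x x' hxx
      obtain ⟨h1, h2⟩ := Prod.mk.inj hxx
      have := h (x - x') ((hL _).1 (by rw [map_sub, h1, sub_self]))
        (fun j hj => by simpa [sub_eq_zero] using congrFun h2 ⟨j, hj⟩)
      simpa [sub_eq_zero] using this
    exact ⟨fun a b => Function.extend
      (fun x : ι → K => (L x, fun j : {j // j ∈ X} => x j.val)) (fun x => x k) 0 (a, b),
      fun x => hf.extend_apply 0 x⟩

/-- The vectors annihilated by `G` are those orthogonal to its column space. -/
lemma vecMulLinear_eq_zero_iff {K ι τ : Type*} [Field K] [Fintype ι] (G : Matrix ι τ K)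
    (x : ι → K) :
    G.vecMulLinear x = 0 ↔ ∀ c ∈ Submodule.span K (Set.range G.col), x ⬝ᵥ c = 0 := by
  constructor
  · intro h c hc
    induction hc using Submodule.span_induction with
    | mem c hc =>
      obtain ⟨t, rfl⟩ := hc
      exact congrFun h t
    | zero => exact dotProduct_zero x
    | add a b _ _ ha hb => rw [dotProduct_add, ha, hb, add_zero]
    | smul r a _ ha => rw [dotProduct_smul, ha, smul_zero]
  · intro h
    ext t
    exact h _ (Submodule.subset_span ⟨t, rfl⟩)

/-- Subspaces `C₁`, `C₂` of column vectors supported in `M₁`, `M₂` that serve all receivers. -/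
structure IsCellCodeSpaces {n : ℕ} (M1 M2 R1 R2 Rc : Finset (Fin n)) (X : Fin n → Finset (Fin n))
    (C₁ C₂ : Submodule (ZMod 2) (Fin n → ZMod 2)) : Prop where
  le_left : C₁ ≤ supportedIn (ZMod 2) M1
  le_right : C₂ ≤ supportedIn (ZMod 2) M2
  decode_left : ∀ k ∈ R1, ∃ c ∈ C₁, c k = 1 ∧ ∀ i, i ≠ k → i ∉ X k → c i = 0
  decode_right : ∀ k ∈ R2, ∃ c ∈ C₂, c k = 1 ∧ ∀ i, i ≠ k → i ∉ X k → c i = 0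
  decode_both : ∀ k ∈ Rc, ∃ c ∈ C₁ ⊔ C₂, c k = 1 ∧ ∀ i, i ≠ k → i ∉ X k → c i = 0

/-- A pair of generator matrices is a code iff their column spaces serve all receivers. -/
lemma isCellIC_iff {n : ℕ} {M1 M2 R1 R2 Rc : Finset (Fin n)} {X : Fin n → Finset (Fin n)}
    (hX : ∀ k, k ∉ X k) (N : ℕ) :
    IsCellIC n M1 M2 R1 R2 Rc X N ↔
      ∃ (N1 N2 : ℕ) (G1 : Matrix (Fin n) (Fin N1) (ZMod 2))
        (G2 : Matrix (Fin n) (Fin N2) (ZMod 2)), N = N1 + N2 ∧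
        IsCellCodeSpaces M1 M2 R1 R2 Rc X (Submodule.span (ZMod 2) (Set.range G1.col))
          (Submodule.span (ZMod 2) (Set.range G2.col)) := by
  unfold IsCellIC
  refine exists_congr fun N1 => exists_congr fun N2 => exists_congr fun G1 =>
    exists_congr fun G2 => and_congr_right fun _ => ?_
  have hsupp : ∀ {N : ℕ} (G : Matrix (Fin n) (Fin N) (ZMod 2)) (M : Finset (Fin n)),
      (∀ r, r ∉ M → ∀ t, G r t = 0) ↔
        Submodule.span (ZMod 2) (Set.range G.col) ≤ supportedIn (ZMod 2) M := by
    intro N G M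
    rw [Submodule.span_le]
    constructor
    · rintro h _ ⟨t, rfl⟩ r hr
      exact h r hr t
    · intro h r hr t
      exact h ⟨t, rfl⟩ r hr
  have hdec : ∀ {N : ℕ} (G : Matrix (Fin n) (Fin N) (ZMod 2)) (k : Fin n),
      (∃ D : (Fin N → ZMod 2) → ({j : Fin n // j ∈ X k} → ZMod 2) → ZMod 2,
        ∀ x : Fin n → ZMod 2, D (fun t => ∑ r, x r * G r t) (fun j => x j.val) = x k) ↔ _ :=
    fun G k => exists_decoder_iff G.vecMulLinear _ (vecMulLinear_eq_zero_iff G) (hX k)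
  have hboth : ∀ k : Fin n,
      (∃ D : (Fin N1 → ZMod 2) → (Fin N2 → ZMod 2) →
          ({j : Fin n // j ∈ X k} → ZMod 2) → ZMod 2,
        ∀ x : Fin n → ZMod 2, D (fun t => ∑ r, x r * G1 r t) (fun t => ∑ r, x r * G2 r t)
          (fun j => x j.val) = x k) ↔
      ∃ c ∈ Submodule.span (ZMod 2) (Set.range G1.col) ⊔
          Submodule.span (ZMod 2) (Set.range G2.col),
        c k = 1 ∧ ∀ i, i ≠ k → i ∉ X k → c i = 0 := by
    intro k
    rw [← exists_decoder_iff (G1.vecMulLinear.prod G2.vecMulLinear) _ ?_ (hX k)]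
    · constructor
      · rintro ⟨D, hD⟩
        exact ⟨fun p => D p.1 p.2, hD⟩
      · rintro ⟨D, hD⟩
        exact ⟨fun a b => D (a, b), hD⟩
    · intro x
      refine Prod.mk_eq_zero.trans ?_
      rw [vecMulLinear_eq_zero_iff, vecMulLinear_eq_zero_iff]
      constructor
      · rintro ⟨h1, h2⟩ c hc
        obtain ⟨a, ha, b, hb, rfl⟩ := Submodule.mem_sup.1 hc
        rw [dotProduct_add, h1 a ha, h2 b hb, add_zero]
      · exact fun h => ⟨fun c hc => h c (Submodule.mem_sup_left hc),
          fun c hc => h c (Submodule.mem_sup_right hc)⟩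
  simp only [hdec, hboth, hsupp]
  exact ⟨fun ⟨a, b, c, d, e⟩ => ⟨a, b, c, d, e⟩, fun ⟨a, b, c, d, e⟩ => ⟨a, b, c, d, e⟩⟩

/-- Every subspace is the column space of a matrix with as many columns as its dimension. -/
lemma exists_matrix_span_col_eq {K : Type*} [Field K] {n : ℕ} (C : Submodule K (Fin n → K)) :
    ∃ G : Matrix (Fin n) (Fin (Module.finrank K C)) K,
      Submodule.span K (Set.range G.col) = C := by
  let b := Module.finBasis K C
  refine ⟨fun r t => (b t : Fin n → K) r, ?_⟩
  have h := congrArg (Submodule.map C.subtype) b.span_eq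
  rw [Submodule.map_span, ← Set.range_comp, Submodule.map_top, Submodule.range_subtype] at h
  exact h

/-- Two sets of natural numbers each of which is bounded below by elements of the other have the
same infimum. -/
lemma Nat.sInf_eq_of_forall_exists_le {S T : Set ℕ} (h₁ : ∀ a ∈ S, ∃ b ∈ T, b ≤ a)
    (h₂ : ∀ b ∈ T, ∃ a ∈ S, a ≤ b) : sInf S = sInf T := by
  rcases S.eq_empty_or_nonempty with rfl | hS
  · rcases T.eq_empty_or_nonempty with rfl | ⟨b, hb⟩
    · rfl
    · obtain ⟨a, ha, -⟩ := h₂ b hb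
      exact ha.elim
  · obtain ⟨b, hb, hbS⟩ := h₁ _ (Nat.sInf_mem hS)
    obtain ⟨a, ha, haT⟩ := h₂ _ (Nat.sInf_mem ⟨b, hb⟩)
    exact le_antisymm ((Nat.sInf_le ha).trans haT) ((Nat.sInf_le hb).trans hbS)

theorem stmt_9 (n : ℕ) (M1 M2 R1 R2 Rc : Finset (Fin n)) (X : Fin n → Finset (Fin n))
    (hM : M1 ∪ M2 = Finset.univ) (hpart : R1 ∪ R2 ∪ Rc = Finset.univ)
    (h12 : Disjoint R1 R2) (h1c : Disjoint R1 Rc) (h2c : Disjoint R2 Rc)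
    (hX : ∀ k : Fin n, k ∉ X k)
    (hR1 : ∀ k ∈ R1, k ∈ M1 ∧ X k ⊆ M1) (hR2 : ∀ k ∈ R2, k ∈ M2 ∧ X k ⊆ M2) :
    NOptCell n M1 M2 R1 R2 Rc X =
      sInf {d | ∃ (F1 : {k : Fin n // k ∈ R1} → Fin n → ZMod 2)
          (F2 : {k : Fin n // k ∈ R2} → Fin n → ZMod 2)
          (F3 : {k : Fin n // k ∈ Rc} → Fin 2 → Fin n → ZMod 2),
        IsCellFitting n M1 M2 R1 R2 Rc X F1 F2 F3 ∧
        d = Module.finrank (ZMod 2)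
              ↥(spanOf n F1 ⊔ spanOf n F2 ⊔ spanOf n (fun p : {k : Fin n // k ∈ Rc} × Fin 2 => F3 p.1 p.2)) +
            Module.finrank (ZMod 2) ↥(spanOf n F1 ⊓ spanOf n F2)} := by
  refine Nat.sInf_eq_of_forall_exists_le ?_ ?_
  · intro N hN
    obtain ⟨N1, N2, G1, G2, rfl, hC⟩ := (isCellIC_iff hX N).1 hN
    have hN1 := finrank_range_le_card (R := ZMod 2) G1.col
    have hN2 := finrank_range_le_card (R := ZMod 2) G2.col
    rw [Fintype.card_fin, Set.finrank] at hN1 hN2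
    generalize Submodule.span (ZMod 2) (Set.range G1.col) = C₁ at hC hN1
    generalize Submodule.span (ZMod 2) (Set.range G2.col) = C₂ at hC hN2
    choose! f₁ hf₁ using hC.decode_left
    choose! f₂ hf₂ using hC.decode_right
    have hb : ∀ k ∈ Rc, ∃ a b : Fin n → ZMod 2, a ∈ C₁ ∧ b ∈ C₂ ∧ a k + b k = 1 ∧
        ∀ i, i ≠ k → i ∉ X k → a i + b i = 0 := by
      intro k hk
      obtain ⟨c, hc, hck⟩ := hC.decode_both k hk
      obtain ⟨a, ha, b, hb, rfl⟩ := Submodule.mem_sup.1 hc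
      exact ⟨a, b, ha, hb, hck⟩
    choose! g₁ g₂ hg using hb
    refine ⟨_, ⟨fun k => f₁ k, fun k => f₂ k, fun k => ![g₁ k, g₂ k],
      ⟨fun k => (hf₁ k k.2).2, fun k => (hf₂ k k.2).2, fun k =>
        ⟨hC.le_left (hg k k.2).1, hC.le_right (hg k k.2).2.1, (hg k k.2).2.2⟩⟩, rfl⟩, ?_⟩
    have hs₁ : spanOf n (fun k : {k // k ∈ R1} => f₁ k) ≤ C₁ := by
      refine Submodule.span_le.2 ?_
      rintro _ ⟨k, rfl⟩
      exact (hf₁ k k.2).1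
    have hs₂ : spanOf n (fun k : {k // k ∈ R2} => f₂ k) ≤ C₂ := by
      refine Submodule.span_le.2 ?_
      rintro _ ⟨k, rfl⟩
      exact (hf₂ k k.2).1
    have hs₃ : spanOf n (fun p : {k // k ∈ Rc} × Fin 2 => ![g₁ p.1, g₂ p.1] p.2) ≤ C₁ ⊔ C₂ := by
      refine Submodule.span_le.2 ?_
      rintro _ ⟨⟨k, l⟩, rfl⟩
      fin_cases l
      · exact Submodule.mem_sup_left (hg k k.2).1
      · exact Submodule.mem_sup_right (hg k k.2).2.1
    calc _ ≤ Module.finrank (ZMod 2) ↥(C₁ ⊔ C₂) + Module.finrank (ZMod 2) ↥(C₁ ⊓ C₂) :=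
          Nat.add_le_add (Submodule.finrank_mono (sup_le (sup_le_sup hs₁ hs₂) hs₃))
            (Submodule.finrank_mono (inf_le_inf hs₁ hs₂))
      _ = Module.finrank (ZMod 2) C₁ + Module.finrank (ZMod 2) C₂ :=
          Submodule.finrank_sup_add_finrank_inf_eq C₁ C₂
      _ ≤ N1 + N2 := Nat.add_le_add hN1 hN2
  · rintro _ ⟨F1, F2, F3, ⟨h1, h2, h3⟩, rfl⟩
    have hsum : spanOf n F1 ⊔ spanOf n F2 ⊔
        spanOf n (fun p : {k : Fin n // k ∈ Rc} × Fin 2 => F3 p.1 p.2) =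
        (spanOf n F1 ⊔ spanOf n (fun k => F3 k 0)) ⊔
          (spanOf n F2 ⊔ spanOf n (fun k => F3 k 1)) := by
      have : spanOf n (fun p : {k : Fin n // k ∈ Rc} × Fin 2 => F3 p.1 p.2) =
          spanOf n (fun k => F3 k 0) ⊔ spanOf n (fun k => F3 k 1) := by
        unfold spanOf
        rw [← Submodule.span_union]
        congr 1
        ext v
        simp [Fin.exists_fin_two, exists_or]
      rw [this, sup_sup_sup_comm]
    obtain ⟨C₁, C₂, hV₁, hA, hV₂, hB, hC, hle⟩ := exists_intermediate_sup_eq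
      (le_sup_left : spanOf n F1 ≤ spanOf n F1 ⊔ spanOf n (fun k => F3 k 0))
      (le_sup_left : spanOf n F2 ≤ spanOf n F2 ⊔ spanOf n (fun k => F3 k 1))
    rw [hsum]
    refine ⟨_, ?_, hle⟩
    obtain ⟨G1, hG1⟩ := exists_matrix_span_col_eq C₁
    obtain ⟨G2, hG2⟩ := exists_matrix_span_col_eq C₂
    refine (isCellIC_iff hX _).2 ⟨_, _, G1, G2, rfl, ?_⟩
    rw [hG1, hG2]
    refine ⟨hA.trans (sup_le (Submodule.span_le.2 ?_) (Submodule.span_le.2 ?_)),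
      hB.trans (sup_le (Submodule.span_le.2 ?_) (Submodule.span_le.2 ?_)), fun k hk => ?_,
      fun k hk => ?_, fun k hk => ?_⟩
    · rintro _ ⟨k, rfl⟩ i hi
      exact (h1 k).2 i (fun e => hi (e ▸ (hR1 k k.2).1)) (fun e => hi ((hR1 k k.2).2 e))
    · rintro _ ⟨k, rfl⟩
      exact (h3 k).1
    · rintro _ ⟨k, rfl⟩ i hi
      exact (h2 k).2 i (fun e => hi (e ▸ (hR2 k k.2).1)) (fun e => hi ((hR2 k k.2).2 e))
    · rintro _ ⟨k, rfl⟩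
      exact (h3 k).2.1
    · exact ⟨F1 ⟨k, hk⟩, hV₁ (Submodule.subset_span ⟨_, rfl⟩), h1 ⟨k, hk⟩⟩
    · exact ⟨F2 ⟨k, hk⟩, hV₂ (Submodule.subset_span ⟨_, rfl⟩), h2 ⟨k, hk⟩⟩
    · refine ⟨F3 ⟨k, hk⟩ 0 + F3 ⟨k, hk⟩ 1, ?_, (h3 ⟨k, hk⟩).2.2⟩
      rw [hC]
      exact Submodule.add_mem_sup (Submodule.mem_sup_right (Submodule.subset_span ⟨⟨k, hk⟩, rfl⟩))
        (Submodule.mem_sup_right (Submodule.subset_span ⟨⟨k, hk⟩, rfl⟩))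
end

section
/- In the cellular two-sender setting, for i, j ∈ {1,2} with i ≠ j, side information of receivers indexed in R(s_i) lying in M_j ∖ M_i is not critical: N_opt^2(G,M,R) = N_opt^2(G',M,R), where G' is obtained from G by replacing X_k with X_k ∖ (M_j ∖ M_i) for every k ∈ R(s_i) and every i ∈ {1,2}. -/
open Matrix BigOperators


/-- Side information about messages unknown to the sender is not critical for a receiver
that hears only this sender. -/
theorem exists_decoder_iff_sdiff {n N : ℕ} {M S Y Y' : Finset (Fin n)}
    {G : Matrix (Fin n) (Fin N) (ZMod 2)} {k : Fin n}
    (hG : ∀ r : Fin n, r ∉ M → ∀ t, G r t = 0) (hk : k ∉ Y) (hS : Disjoint S M)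
    (hY : Y' = Y \ S) :
    (∃ D : (Fin N → ZMod 2) → ({j : Fin n // j ∈ Y} → ZMod 2) → ZMod 2,
      ∀ x : Fin n → ZMod 2, D (fun t => ∑ r, x r * G r t) (fun j => x j.val) = x k) ↔
    (∃ D : (Fin N → ZMod 2) → ({j : Fin n // j ∈ Y'} → ZMod 2) → ZMod 2,
      ∀ x : Fin n → ZMod 2, D (fun t => ∑ r, x r * G r t) (fun j => x j.val) = x k) := by
  subst hY
  have hGS : ∀ r ∈ S, ∀ t, G r t = 0 := fun r hr => hG r (Finset.disjoint_left.mp hS hr)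
  constructor
  · rintro ⟨D, hD⟩
    have hkS : k ∉ S := by
      intro hkS
      have h0 := hD 0
      have h1 := hD (Pi.single k 1)
      have hc : (fun t => ∑ r, (Pi.single k 1 : Fin n → ZMod 2) r * G r t) =
          fun t => ∑ r, (0 : Fin n → ZMod 2) r * G r t := by
        funext t
        refine Finset.sum_congr rfl fun r _ => ?_
        by_cases hr : r = k
        · subst hr
          simp [hGS r hkS]
        · simp [hr]
      have hs : (fun j : {j : Fin n // j ∈ Y} => (Pi.single k 1 : Fin n → ZMod 2) j.val) =
          fun j => (0 : Fin n → ZMod 2) j.val := by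
        funext j
        have hj : j.val ≠ k := fun h => hk (h ▸ j.2)
        simp [hj]
      rw [hc, hs, h0] at h1
      simp at h1
    refine ⟨fun c y => D c fun j =>
      if h : j.val ∈ S then 0 else y ⟨j.val, Finset.mem_sdiff.mpr ⟨j.2, h⟩⟩, fun x => ?_⟩
    have h := hD fun r => if r ∈ S then 0 else x r
    have hc : (fun t => ∑ r, (if r ∈ S then 0 else x r) * G r t) =
        fun t => ∑ r, x r * G r t := by
      funext t
      refine Finset.sum_congr rfl fun r _ => ?_
      by_cases hr : r ∈ S
      · simp [hGS r hr]
      · simp [hr]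
    rw [hc, if_neg hkS] at h
    simpa using h
  · rintro ⟨D, hD⟩
    exact ⟨fun c y => D c fun j => y ⟨j.val, (Finset.mem_sdiff.mp j.2).1⟩, fun x => hD x⟩

theorem stmt_10 (n : ℕ) (M1 M2 R1 R2 Rc : Finset (Fin n)) (X : Fin n → Finset (Fin n))
    (hM : M1 ∪ M2 = Finset.univ) (hpart : R1 ∪ R2 ∪ Rc = Finset.univ)
    (h12 : Disjoint R1 R2) (h1c : Disjoint R1 Rc) (h2c : Disjoint R2 Rc)
    (hX : ∀ k : Fin n, k ∉ X k) :
    NOptCell n M1 M2 R1 R2 Rc X =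
      NOptCell n M1 M2 R1 R2 Rc (fun k : Fin n =>
        if k ∈ R1 then X k \ (M2 \ M1)
        else if k ∈ R2 then X k \ (M1 \ M2)
        else X k) := by
  unfold NOptCell
  congr 1
  ext N
  simp only [Set.mem_ofPred_eq]
  unfold IsCellIC
  refine exists_congr fun N1 => exists_congr fun N2 => exists_congr fun G1 =>
    exists_congr fun G2 => and_congr_right fun _ => and_congr_right fun hG1 =>
    and_congr_right fun hG2 => and_congr ?_ (and_congr ?_ ?_)
  · refine forall₂_congr fun k hk => ?_
    exact exists_decoder_iff_sdiff hG1 (hX k) Finset.sdiff_disjoint (if_pos hk)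
  · refine forall₂_congr fun k hk => ?_
    exact exists_decoder_iff_sdiff hG2 (hX k) Finset.sdiff_disjoint
      ((if_neg (Finset.disjoint_right.mp h12 hk)).trans (if_pos hk))
  · refine forall₂_congr fun k hk => ?_
    beta_reduce
    rw [if_neg (Finset.disjoint_right.mp h1c hk), if_neg (Finset.disjoint_right.mp h2c hk)]
end

section
/- Suppose k ∈ M_i and X_k ⊆ M_i for every k ∈ R(s_i), i = 1,2. There exists a cellular fitting matrix F for the (G,M,R)-IC with V_1 ∩ V_2 ≠ {0} if and only if there exists a set T ⊆ R(s_1) ∪ R(s_2) with T ∩ R(s_1) ≠ ∅ and T ∩ R(s_2) ≠ ∅ such that every j ∈ T satisfies j ∈ X_k for at least one k ∈ T, and at least one of the following holds: (1) some k ∈ T ∩ R(s_1) and j ∈ T ∩ R(s_2) satisfy j ∈ X_k, or some k ∈ T ∩ R(s_2) and j ∈ T ∩ R(s_1) satisfy j ∈ X_k; (2) some k_1 ∈ T ∩ R(s_1) and k_2 ∈ T ∩ R(s_2) have a common side-information index d ∈ X_{k_1} ∩ X_{k_2}. -/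
open Matrix BigOperators


/-- If two combinations of columns agree, a row carrying the diagonal entry of a column used on
the left is hit by another column used on the left, or by one used on the right. -/
lemma exists_other_column {n : ℕ} {R S : Finset (Fin n)}
    {F : {k : Fin n // k ∈ R} → Fin n → ZMod 2} {G : {k : Fin n // k ∈ S} → Fin n → ZMod 2}
    {c : {k : Fin n // k ∈ R} → ZMod 2} {d : {k : Fin n // k ∈ S} → ZMod 2}
    (h : ∑ k, c k • F k = ∑ k, d k • G k) (j : {k : Fin n // k ∈ R})
    (hF : F j j.val = 1) (hj : c j ≠ 0) :
    (∃ k, k ≠ j ∧ c k ≠ 0 ∧ F k j.val ≠ 0) ∨ ∃ k, d k ≠ 0 ∧ G k j.val ≠ 0 := by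
  by_contra! hno
  obtain ⟨hl, hr⟩ := hno
  have hrow := congrFun h j.val
  simp only [Finset.sum_apply, Pi.smul_apply, smul_eq_mul] at hrow
  rw [Finset.sum_eq_single j, Finset.sum_eq_zero, hF, mul_one] at hrow
  · exact hj hrow
  · intro k _
    by_cases hk : d k = 0
    · simp [hk]
    · simp [hr k hk]
  · intro k _ hkj
    by_cases hk : c k = 0
    · simp [hk]
    · simp [hl k hkj hk]
  · simp

/-- A nonzero coordinate of a combination of columns is nonzero in one of the columns used. -/
lemma exists_column_ne_zero {n : ℕ} {α : Type} [Fintype α] {F : α → Fin n → ZMod 2}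
    {c : α → ZMod 2} {i : Fin n} (h : (∑ k, c k • F k) i ≠ 0) :
    ∃ k, c k ≠ 0 ∧ F k i ≠ 0 := by
  rw [Finset.sum_apply] at h
  obtain ⟨k, -, hk⟩ := Finset.exists_ne_zero_of_sum_ne_zero h
  rw [Pi.smul_apply] at hk
  exact ⟨k, left_ne_zero_of_smul hk, right_ne_zero_of_smul hk⟩

/-- Entries that the fitting conditions allow in row `i`: the diagonal entry is `1`, and other
nonzero entries occur only in columns having `i` as side information. -/
def IsFittingRow {n : ℕ} (X : Fin n → Finset (Fin n)) (i : Fin n) (r : Fin n → ZMod 2) : Prop :=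
  r i = 1 ∧ ∀ k, i ≠ k → i ∉ X k → r k = 0

lemma exists_balanced_row {n : ℕ} {X : Fin n → Finset (Fin n)} (hX : ∀ k, k ∉ X k)
    {A B : Finset (Fin n)} (hAB : Disjoint A B)
    (hT : ∀ j ∈ A ∪ B, ∃ k ∈ A ∪ B, j ∈ X k) (i : Fin n) :
    ∃ r, IsFittingRow X i r ∧ ∑ k ∈ A, r k = ∑ k ∈ B, r k := by
  by_cases hi : i ∈ A ∪ B
  · obtain ⟨k, hk, hik⟩ := hT i hi
    have hne : i ≠ k := by rintro rfl; exact hX _ hik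
    refine ⟨Pi.single i 1 + Pi.single k 1, ⟨by simp [hne], ?_⟩, ?_⟩
    · intro l hil hl
      have hkl : k ≠ l := by rintro rfl; exact hl hik
      simp [hil.symm, hkl.symm]
    · rw [← CharTwo.add_eq_zero, ← Finset.sum_union hAB]
      simp only [Pi.add_apply, Finset.sum_add_distrib, Finset.sum_pi_single', if_pos hi, if_pos hk]
      exact CharTwo.add_self_eq_zero 1
  · refine ⟨Pi.single i 1, ⟨by simp, fun l hil _ => by simp [hil.symm]⟩, ?_⟩
    simp only [Finset.mem_union, not_or] at hi
    simp [hi.1, hi.2]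

/-- A row whose sums over `A` and `B` both equal `1`, from side information linking `A` to `B`. -/
lemma exists_linking_row {n : ℕ} {X : Fin n → Finset (Fin n)} (hX : ∀ k, k ∉ X k)
    {A B : Finset (Fin n)} (hAB : Disjoint A B) {k j : Fin n} (hk : k ∈ A) (hj : j ∈ B)
    (hjk : j ∈ X k) :
    ∃ r, IsFittingRow X j r ∧ ∑ k ∈ A, r k = 1 ∧ ∑ k ∈ B, r k = 1 := by
  have hne : j ≠ k := by rintro rfl; exact hX _ hjk
  have hjA := Finset.disjoint_right.1 hAB hj
  have hkB := Finset.disjoint_left.1 hAB hk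
  refine ⟨Pi.single j 1 + Pi.single k 1, ⟨by simp [hne], ?_⟩, ?_, ?_⟩
  · intro l hil hl
    have hkl : k ≠ l := by rintro rfl; exact hl hjk
    simp [hil.symm, hkl.symm]
  · simp [Finset.sum_add_distrib, hk, hjA]
  · simp [Finset.sum_add_distrib, hj, hkB]

lemma exists_common_row {n : ℕ} {X : Fin n → Finset (Fin n)} (hX : ∀ k, k ∉ X k)
    {A B : Finset (Fin n)} (hAB : Disjoint A B) {k₁ k₂ d : Fin n} (hk₁ : k₁ ∈ A) (hk₂ : k₂ ∈ B)
    (hd₁ : d ∈ X k₁) (hd₂ : d ∈ X k₂) :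
    ∃ r, IsFittingRow X d r ∧ ∑ k ∈ A, r k = 1 ∧ ∑ k ∈ B, r k = 1 := by
  by_cases hdA : d ∈ A
  · obtain ⟨r, hr, hB, hA⟩ := exists_linking_row hX hAB.symm hk₂ hdA hd₂
    exact ⟨r, hr, hA, hB⟩
  by_cases hdB : d ∈ B
  · exact exists_linking_row hX hAB hk₁ hdB hd₁
  have h₁ : d ≠ k₁ := by rintro rfl; exact hX _ hd₁
  have h₂ : d ≠ k₂ := by rintro rfl; exact hX _ hd₂
  have hk₁B := Finset.disjoint_left.1 hAB hk₁
  have hk₂A := Finset.disjoint_right.1 hAB hk₂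
  refine ⟨Pi.single d 1 + Pi.single k₁ 1 + Pi.single k₂ 1, ⟨by simp [h₁, h₂], ?_⟩, ?_, ?_⟩
  · intro l hdl hl
    have hl₁ : k₁ ≠ l := by rintro rfl; exact hl hd₁
    have hl₂ : k₂ ≠ l := by rintro rfl; exact hl hd₂
    simp [hdl.symm, hl₁.symm, hl₂.symm]
  · simp [Finset.sum_add_distrib, hk₁, hdA, hk₂A]
  · simp [Finset.sum_add_distrib, hk₂, hdB, hk₁B]

lemma sum_mem_spanOf {n : ℕ} {R A : Finset (Fin n)} (hA : A ⊆ R) (C : Fin n → Fin n → ZMod 2) :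
    ∑ k ∈ A, C k ∈ spanOf n (fun k : {k : Fin n // k ∈ R} => C k.val) :=
  Submodule.sum_mem _ fun k hk => Submodule.subset_span ⟨⟨k, hA hk⟩, rfl⟩

theorem stmt_12 (n : ℕ) (M1 M2 R1 R2 Rc : Finset (Fin n)) (X : Fin n → Finset (Fin n))
    (hM : M1 ∪ M2 = Finset.univ) (hpart : R1 ∪ R2 ∪ Rc = Finset.univ)
    (h12 : Disjoint R1 R2) (h1c : Disjoint R1 Rc) (h2c : Disjoint R2 Rc)
    (hX : ∀ k : Fin n, k ∉ X k)
    (hR1 : ∀ k ∈ R1, k ∈ M1 ∧ X k ⊆ M1) (hR2 : ∀ k ∈ R2, k ∈ M2 ∧ X k ⊆ M2) :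
    (∃ (F1 : {k : Fin n // k ∈ R1} → Fin n → ZMod 2)
        (F2 : {k : Fin n // k ∈ R2} → Fin n → ZMod 2)
        (F3 : {k : Fin n // k ∈ Rc} → Fin 2 → Fin n → ZMod 2),
      IsCellFitting n M1 M2 R1 R2 Rc X F1 F2 F3 ∧
        spanOf n F1 ⊓ spanOf n F2 ≠ ⊥) ↔
      (∃ T : Finset (Fin n), T ⊆ R1 ∪ R2 ∧
        (T ∩ R1).Nonempty ∧ (T ∩ R2).Nonempty ∧
        (∀ j ∈ T, ∃ k ∈ T, j ∈ X k) ∧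
        ((∃ k ∈ T ∩ R1, ∃ j ∈ T ∩ R2, j ∈ X k) ∨
         (∃ k ∈ T ∩ R2, ∃ j ∈ T ∩ R1, j ∈ X k) ∨
         (∃ k1 ∈ T ∩ R1, ∃ k2 ∈ T ∩ R2, ∃ d : Fin n, d ∈ X k1 ∧ d ∈ X k2))) := by
  constructor
  · rintro ⟨F1, F2, F3, ⟨hF1, hF2, -⟩, hne⟩
    obtain ⟨v, ⟨hv1, hv2⟩, hv⟩ := Submodule.exists_mem_ne_zero_of_ne_bot hne
    obtain ⟨c, hc⟩ := (Submodule.mem_span_range_iff_exists_fun _).1 hv1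
    obtain ⟨d, hd⟩ := (Submodule.mem_span_range_iff_exists_fun _).1 hv2
    have hcd := hc.trans hd.symm
    have side1 : ∀ k i, F1 k i ≠ 0 → i ≠ k.val → i ∈ X k.val := fun k i h hik =>
      by_contra fun hi => h ((hF1 k).2 i hik hi)
    have side2 : ∀ k i, F2 k i ≠ 0 → i ≠ k.val → i ∈ X k.val := fun k i h hik =>
      by_contra fun hi => h ((hF2 k).2 i hik hi)
    have sep : ∀ (k : {k // k ∈ R1}) (l : {k // k ∈ R2}), k.val ≠ l.val := fun k l h =>
      Finset.disjoint_left.1 h12 k.2 (h ▸ l.2)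
    obtain ⟨i, hi⟩ := Function.ne_iff.1 hv
    obtain ⟨k1, hk1, hki1⟩ := exists_column_ne_zero (hc ▸ hi)
    obtain ⟨k2, hk2, hki2⟩ := exists_column_ne_zero (hd ▸ hi)
    classical
    let T : Finset (Fin n) := Finset.univ.filter fun k =>
      (∃ h : k ∈ R1, c ⟨k, h⟩ ≠ 0) ∨ ∃ h : k ∈ R2, d ⟨k, h⟩ ≠ 0
    have mem1 : ∀ k : {k // k ∈ R1}, c k ≠ 0 → k.val ∈ T := fun k hk =>
      Finset.mem_filter.2 ⟨Finset.mem_univ _, Or.inl ⟨k.2, hk⟩⟩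
    have mem2 : ∀ k : {k // k ∈ R2}, d k ≠ 0 → k.val ∈ T := fun k hk =>
      Finset.mem_filter.2 ⟨Finset.mem_univ _, Or.inr ⟨k.2, hk⟩⟩
    have hk1T := Finset.mem_inter.2 ⟨mem1 k1 hk1, k1.2⟩
    have hk2T := Finset.mem_inter.2 ⟨mem2 k2 hk2, k2.2⟩
    refine ⟨T, ?_, ⟨_, hk1T⟩, ⟨_, hk2T⟩, ?_, ?_⟩
    · intro k hk
      rcases (Finset.mem_filter.1 hk).2 with ⟨h, -⟩ | ⟨h, -⟩
      · exact Finset.mem_union_left _ h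
      · exact Finset.mem_union_right _ h
    · intro j hj
      rcases (Finset.mem_filter.1 hj).2 with ⟨h, hcj⟩ | ⟨h, hdj⟩
      · rcases exists_other_column hcd ⟨j, h⟩ (hF1 _).1 hcj with ⟨k, hkj, hk, hkv⟩ | ⟨k, hk, hkv⟩
        · exact ⟨k, mem1 k hk, side1 k j hkv fun e => hkj (Subtype.ext e.symm)⟩
        · exact ⟨k, mem2 k hk, side2 k j hkv (sep ⟨j, h⟩ k)⟩
      · rcases exists_other_column hcd.symm ⟨j, h⟩ (hF2 _).1 hdj with
          ⟨k, hkj, hk, hkv⟩ | ⟨k, hk, hkv⟩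
        · exact ⟨k, mem2 k hk, side2 k j hkv fun e => hkj (Subtype.ext e.symm)⟩
        · exact ⟨k, mem1 k hk, side1 k j hkv (sep k ⟨j, h⟩).symm⟩
    · by_cases h1 : i = k1.val
      · subst h1
        exact Or.inr (Or.inl ⟨_, hk2T, _, hk1T, side2 k2 _ hki2 (sep k1 k2)⟩)
      by_cases h2 : i = k2.val
      · subst h2
        exact Or.inl ⟨_, hk1T, _, hk2T, side1 k1 _ hki1 (sep k1 k2).symm⟩
      exact Or.inr (Or.inr ⟨_, hk1T, _, hk2T, i, side1 k1 i hki1 h1, side2 k2 i hki2 h2⟩)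
  · rintro ⟨T, hTR, -, -, hT, hlink⟩
    have hAB : Disjoint (T ∩ R1) (T ∩ R2) :=
      h12.mono Finset.inter_subset_right Finset.inter_subset_right
    have hunion : T ∩ R1 ∪ T ∩ R2 = T := by
      rw [← Finset.inter_union_distrib_left, Finset.inter_eq_left.2 hTR]
    have hspecial : ∃ d r, IsFittingRow X d r ∧
        ∑ k ∈ T ∩ R1, r k = 1 ∧ ∑ k ∈ T ∩ R2, r k = 1 := by
      rcases hlink with ⟨k, hk, j, hj, hjk⟩ | ⟨k, hk, j, hj, hjk⟩ | ⟨k1, hk1, k2, hk2, d, hd1, hd2⟩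
      · exact ⟨j, exists_linking_row hX hAB hk hj hjk⟩
      · obtain ⟨r, hr, hB, hA⟩ := exists_linking_row hX hAB.symm hk hj hjk
        exact ⟨j, r, hr, hA, hB⟩
      · exact ⟨d, exists_common_row hX hAB hk1 hk2 hd1 hd2⟩
    obtain ⟨d, r, hr, hrA, hrB⟩ := hspecial
    have hrows : ∀ i, ∃ s, IsFittingRow X i s ∧
        ∑ k ∈ T ∩ R1, s k = ∑ k ∈ T ∩ R2, s k ∧ (i = d → ∑ k ∈ T ∩ R1, s k = 1) := by
      intro i
      by_cases hid : i = d
      · subst hid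
        exact ⟨r, hr, hrA.trans hrB.symm, fun _ => hrA⟩
      · obtain ⟨s, hs, hsum⟩ := exists_balanced_row hX hAB (hunion.symm ▸ hT) i
        exact ⟨s, hs, hsum, fun h => absurd h hid⟩
    choose s hs hsum hsd using hrows
    refine ⟨fun k i => s i k, fun k i => s i k,
      fun k l => if (l = 0 ↔ k.val ∈ M1) then Pi.single k.val 1 else 0, ⟨?_, ?_, ?_⟩, ?_⟩
    · exact fun k => ⟨(hs _).1, fun i hik hi => (hs i).2 k hik hi⟩
    · exact fun k => ⟨(hs _).1, fun i hik hi => (hs i).2 k hik hi⟩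
    · intro k
      by_cases hk : k.val ∈ M1
      · refine ⟨fun i hi => ?_, fun i _ => by simp [hk], by simp [hk],
        fun i hik _ => by simp [hk, hik]⟩
        have : i ≠ k.val := by rintro rfl; exact hi hk
        simp [hk, this]
      · have hk2 : k.val ∈ M2 :=
          (Finset.mem_union.1 (hM ▸ Finset.mem_univ k.val)).resolve_left hk
        refine ⟨fun i _ => by simp [hk], fun i hi => ?_, by simp [hk],
          fun i hik _ => by simp [hk, hik]⟩
        have : i ≠ k.val := by rintro rfl; exact hi hk2
        simp [hk, this]
    · have hv1 := sum_mem_spanOf (A := T ∩ R1) Finset.inter_subset_right fun k i => s i k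
      have hv2 := sum_mem_spanOf (A := T ∩ R2) Finset.inter_subset_right fun k i => s i k
      have heq : ∑ k ∈ T ∩ R1, (fun i => s i k) = ∑ k ∈ T ∩ R2, (fun i => s i k) := by
        ext i
        simpa only [Finset.sum_apply] using hsum i
      refine (Submodule.ne_bot_iff _).2 ⟨_, ⟨hv1, heq ▸ hv2⟩, fun h0 => ?_⟩
      have := congrFun h0 d
      simp [Finset.sum_apply, hsd d rfl] at this
end

section
/- In the cellular two-sender setting with k ∈ M_i for every k ∈ R(s_i) (i = 1,2), suppose there exist t ≥ 2 distinct indices i_1,…,i_t all belonging to R(s_1), or all belonging to R(s_2), forming a directed cycle in G, i.e., i_{l+1} ∈ X_{i_l} for all l (indices modulo t). Then index codelength can be reduced: N_opt^2(G,M,R) ≤ n − 1. -/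
open Matrix BigOperators


/-- Interchanging the two senders preserves cellular index codes. -/
theorem IsCellIC.swap {n : ℕ} {M1 M2 R1 R2 Rc : Finset (Fin n)} {X : Fin n → Finset (Fin n)}
    {N : ℕ} (h : IsCellIC n M1 M2 R1 R2 Rc X N) : IsCellIC n M2 M1 R2 R1 Rc X N := by
  obtain ⟨N1, N2, G1, G2, hN, hG1, hG2, hD1, hD2, hDc⟩ := h
  refine ⟨N2, N1, G2, G1, by omega, hG2, hG1, hD2, hD1, fun k hk => ?_⟩
  obtain ⟨D, hD⟩ := hDc k hk
  exact ⟨fun y z s => D z y s, hD⟩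

/-- If the values of `f` and `g` determine the value of `h`, then `h` can be computed
from them. -/
theorem exists_decoder {α β γ δ : Type*} [Nonempty δ] (f : α → β) (g : α → γ) (h : α → δ)
    (hfg : ∀ x y, f x = f y → g x = g y → h x = h y) :
    ∃ D : β → γ → δ, ∀ x, D (f x) (g x) = h x := by
  have hfac : Function.FactorsThrough h fun x => (f x, g x) := fun x y hxy =>
    hfg x y (congrArg Prod.fst hxy) (congrArg Prod.snd hxy)
  obtain ⟨e, he⟩ := (Function.factorsThrough_iff h).1 hfac
  exact ⟨fun b c => e (b, c), fun x => (congrFun he x).symm⟩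

/-- A cycle among the receivers of the first sender yields a code of length `n - 1`: the first
sender transmits `x k + x (c 0)` for the messages `k ≠ c 0` on the cycle, and all messages off
the cycle are sent uncoded. -/
theorem isCellIC_of_cycle {n : ℕ} {M1 M2 R1 R2 Rc : Finset (Fin n)}
    {X : Fin n → Finset (Fin n)}
    (hM : M1 ∪ M2 = Finset.univ) (hpart : R1 ∪ R2 ∪ Rc = Finset.univ)
    (h12 : Disjoint R1 R2) (h2c : Disjoint R2 Rc)
    (hR1M : ∀ k ∈ R1, k ∈ M1) (hR2M : ∀ k ∈ R2, k ∈ M2)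
    {t : ℕ} [NeZero t] (c : Fin t → Fin n) (hmem : ∀ l : Fin t, c l ∈ R1)
    (hcyc : ∀ l : Fin t, c (l + 1) ∈ X (c l)) :
    IsCellIC n M1 M2 R1 R2 Rc X (n - 1) := by
  classical
  set S1 : Finset (Fin n) := R1 ∪ (Rc ∩ M1) with hS1
  set S2 : Finset (Fin n) := R2 ∪ (Rc \ M1) with hS2
  have hcover : S1 ∪ S2 = Finset.univ := by
    ext k
    have := Finset.ext_iff.1 hpart k
    simp only [hS1, hS2, Finset.mem_union, Finset.mem_inter, Finset.mem_sdiff,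
      Finset.mem_univ, iff_true] at this ⊢
    tauto
  have hdisj : Disjoint S1 S2 := by
    rw [Finset.disjoint_left] at h12 h2c ⊢
    intro k hk hk'
    have a1 := @h12 k
    have a2 := @h2c k
    have a3 := hR1M k
    simp only [hS1, hS2, Finset.mem_union, Finset.mem_inter, Finset.mem_sdiff] at hk hk'
    tauto
  have hS1M : ∀ k ∈ S1, k ∈ M1 := by
    intro k hk
    simp only [hS1, Finset.mem_union, Finset.mem_inter] at hk
    exact hk.elim (hR1M k) And.right
  have hS2M : ∀ k ∈ S2, k ∈ M2 := by
    intro k hk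
    have := Finset.ext_iff.1 hM k
    have a := hR2M k
    simp only [hS2, Finset.mem_union, Finset.mem_sdiff, Finset.mem_univ, iff_true] at hk this
    tauto
  have hc0 : c 0 ∈ S1 := Finset.mem_union_left _ (hmem 0)
  have hcard : (S1.erase (c 0)).card + S2.card = n - 1 := by
    have h1 := Finset.card_union_of_disjoint hdisj
    rw [hcover, Finset.card_univ, Fintype.card_fin] at h1
    have h2 := Finset.card_erase_add_one hc0
    omega
  let e1 := (S1.erase (c 0)).equivFin
  let e2 := S2.equivFin
  let a : (Fin n → ZMod 2) → Fin n → ZMod 2 := fun x k =>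
    x k + if k ∈ Set.range c then x (c 0) else 0
  let G1 : Matrix (Fin n) (Fin (S1.erase (c 0)).card) (ZMod 2) := fun r j =>
    (if r = (e1.symm j).val then 1 else 0) +
      if (e1.symm j).val ∈ Set.range c then (if r = c 0 then 1 else 0) else 0
  let G2 : Matrix (Fin n) (Fin S2.card) (ZMod 2) := fun r j =>
    if r = (e2.symm j).val then 1 else 0
  have hG1 : ∀ x j, ∑ r, x r * G1 r j = a x (e1.symm j).val := by
    intro x j
    by_cases h : (e1.symm j).val ∈ Set.range c <;>
      simp only [G1, a, h, if_true, if_false, mul_add, Finset.sum_add_distrib] <;> simp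
  have hG2 : ∀ (x : Fin n → ZMod 2) j, ∑ r, x r * G2 r j = x (e2.symm j).val := by
    intro x j
    simp [G2]
  have key1 : ∀ x y : Fin n → ZMod 2, (fun j => ∑ r, x r * G1 r j) = (fun j => ∑ r, y r * G1 r j) →
      ∀ k ∈ S1, a x k = a y k := by
    intro x y hxy k hk
    by_cases hk0 : k = c 0
    · subst hk0
      simp [a, CharTwo.add_self_eq_zero]
    · have := congrFun hxy (e1 ⟨k, Finset.mem_erase.2 ⟨hk0, hk⟩⟩)
      simpa only [hG1, Equiv.symm_apply_apply] using this
  have key2 : ∀ x y : Fin n → ZMod 2, (fun j => ∑ r, x r * G2 r j) = (fun j => ∑ r, y r * G2 r j) →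
      ∀ k ∈ S2, x k = y k := by
    intro x y hxy k hk
    have := congrFun hxy (e2 ⟨k, hk⟩)
    simpa only [hG2, Equiv.symm_apply_apply] using this
  have off_cycle : ∀ (x y : Fin n → ZMod 2) (k : Fin n), k ∉ Set.range c → a x k = a y k → x k = y k := by
    intro x y k hk h
    simpa only [a, hk, if_false, add_zero] using h
  have hdec1 : ∀ k ∈ R1, ∀ x y : Fin n → ZMod 2, (∀ i ∈ S1, a x i = a y i) → (∀ j ∈ X k, x j = y j) →
      x k = y k := by
    intro k hk x y hxy hside
    by_cases h : k ∈ Set.range c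
    · obtain ⟨l, rfl⟩ := h
      have h1 := hxy _ (Finset.mem_union_left _ (hmem l))
      have h2 := hxy _ (Finset.mem_union_left _ (hmem (l + 1)))
      simp only [a, Set.mem_range_self, if_true] at h1 h2
      rw [hside _ (hcyc l)] at h2
      rw [add_left_cancel h2] at h1
      exact add_right_cancel h1
    · exact off_cycle x y k h (hxy k (Finset.mem_union_left _ hk))
  refine ⟨_, _, G1, G2, hcard.symm, ?_, ?_, ?_, ?_, ?_⟩
  · intro r hr j
    have h1 : r ≠ (e1.symm j).val := fun h =>
      hr (h ▸ hS1M _ (Finset.mem_of_mem_erase (e1.symm j).2))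
    have h2 : r ≠ c 0 := fun h => hr (h ▸ hS1M _ hc0)
    simp [G1, h1, h2]
  · intro r hr j
    have h1 : r ≠ (e2.symm j).val := fun h => hr (h ▸ hS2M _ (e2.symm j).2)
    simp [G2, h1]
  · intro k hk
    exact exists_decoder _ (fun (x : Fin n → ZMod 2) (j : {j : Fin n // j ∈ X k}) => x j.val)
      (fun x => x k) fun x y hxy hside =>
        hdec1 k hk x y (key1 x y hxy) fun j hj => congrFun hside ⟨j, hj⟩
  · intro k hk
    exact exists_decoder _ (fun (x : Fin n → ZMod 2) (j : {j : Fin n // j ∈ X k}) => x j.val)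
      (fun x => x k) fun x y hxy _ => key2 x y hxy k (Finset.mem_union_left _ hk)
  · intro k hk
    obtain ⟨D, hD⟩ := exists_decoder
      (fun x : Fin n → ZMod 2 => ((fun j => ∑ r, x r * G1 r j), fun j => ∑ r, x r * G2 r j))
      (fun (x : Fin n → ZMod 2) (j : {j : Fin n // j ∈ X k}) => x j.val)
      (fun x => x k) (by
        intro x y hxy hside
        have h1 := key1 x y (congrArg Prod.fst hxy)
        have h2 := key2 x y (congrArg Prod.snd hxy)
        by_cases hkc : k ∈ Set.range c
        · obtain ⟨l, rfl⟩ := hkc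
          exact hdec1 _ (hmem l) x y h1 fun j hj => congrFun hside ⟨j, hj⟩
        · rcases Finset.mem_union.1 (hcover ▸ Finset.mem_univ k) with hS | hS
          · exact off_cycle x y k hkc (h1 k hS)
          · exact h2 k hS)
    exact ⟨fun u v s => D (u, v) s, hD⟩

theorem stmt_13 (n : ℕ) (M1 M2 R1 R2 Rc : Finset (Fin n)) (X : Fin n → Finset (Fin n))
    (hM : M1 ∪ M2 = Finset.univ) (hpart : R1 ∪ R2 ∪ Rc = Finset.univ)
    (h12 : Disjoint R1 R2) (h1c : Disjoint R1 Rc) (h2c : Disjoint R2 Rc)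
    (hX : ∀ k : Fin n, k ∉ X k)
    (hR1M : ∀ k ∈ R1, k ∈ M1) (hR2M : ∀ k ∈ R2, k ∈ M2)
    (t : ℕ) [NeZero t] (ht : 2 ≤ t) (c : Fin t → Fin n)
    (hinj : Function.Injective c)
    (hmem : (∀ l : Fin t, c l ∈ R1) ∨ (∀ l : Fin t, c l ∈ R2))
    (hcyc : ∀ l : Fin t, c (l + 1) ∈ X (c l)) :
    NOptCell n M1 M2 R1 R2 Rc X ≤ n - 1 := by
  refine Nat.sInf_le ?_
  rcases hmem with h | h
  · exact isCellIC_of_cycle hM hpart h12 h2c hR1M hR2M c h hcyc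
  · exact (isCellIC_of_cycle (by rwa [Finset.union_comm]) (by rwa [Finset.union_comm R2])
      h12.symm h1c hR2M hR1M c h hcyc).swap
end

section
/- In the cellular two-sender setting with k ∈ M_i for every k ∈ R(s_i) (i = 1,2), suppose the instance is a single directed cycle: R(s_c) = ∅, R(s_1) ≠ ∅, R(s_2) ≠ ∅, n ≥ 2, and there is a cyclic permutation σ of {1,…,n} such that X_k = {σ(k)} for every k. Then index codelength cannot be reduced: N_opt^2(G,M,R) = n. -/
open Matrix BigOperators


/-- If every message indexed in a set `R` missing some point of the cycle `σ` can be decoded from a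
common codeword of length `N` and the next message along `σ`, then `N` is at least `|R|`. -/
lemma card_le_of_cycle_decoding {n N : ℕ} (R : Finset (Fin n)) (X : Fin n → Finset (Fin n))
    (σ : Equiv.Perm (Fin n)) (hcycle : σ.IsCycle) (hsupp : σ.support = Finset.univ)
    (hX : ∀ k, X k = {σ k}) (hR : ∃ j, j ∉ R) (E : (Fin n → ZMod 2) → Fin N → ZMod 2)
    (hdec : ∀ k ∈ R, ∃ D : (Fin N → ZMod 2) → ({j : Fin n // j ∈ X k} → ZMod 2) → ZMod 2,
      ∀ x : Fin n → ZMod 2, D (E x) (fun j => x j.val) = x k) :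
    R.card ≤ N := by
  classical
  obtain ⟨j, hj⟩ := hR
  have hmove : ∀ k, σ k ≠ k := fun k => by
    rw [← Equiv.Perm.mem_support, hsupp]
    exact Finset.mem_univ k
  let zeroExt : ({k // k ∈ R} → ZMod 2) → Fin n → ZMod 2 :=
    fun u k => if h : k ∈ R then u ⟨k, h⟩ else 0
  have hinj : Function.Injective (fun u => E (zeroExt u)) := by
    intro u v huv
    have huv' : E (zeroExt u) = E (zeroExt v) := huv
    have hstep : ∀ k, zeroExt u k ≠ zeroExt v k → zeroExt u (σ k) ≠ zeroExt v (σ k) := by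
      intro k hk heq
      by_cases hkR : k ∈ R
      · obtain ⟨D, hD⟩ := hdec k hkR
        apply hk
        rw [← hD (zeroExt u), ← hD (zeroExt v), huv']
        congr 1
        funext i
        have hi : i.val = σ k := Finset.mem_singleton.mp (hX k ▸ Subtype.property i)
        rw [hi, heq]
      · exact hk (by simp [zeroExt, hkR])
    have hpow : ∀ k, zeroExt u k ≠ zeroExt v k → ∀ i : ℕ,
        zeroExt u ((σ ^ i) k) ≠ zeroExt v ((σ ^ i) k) := by
      intro k hk i
      induction i with
      | zero => simpa using hk
      | succ i ih =>
        rw [pow_succ', Equiv.Perm.mul_apply]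
        exact hstep _ ih
    funext k
    by_contra hne
    have hk : zeroExt u k ≠ zeroExt v k := by simpa [zeroExt, k.property] using hne
    obtain ⟨i, hi⟩ := hcycle.exists_pow_eq (hmove k) (hmove j)
    apply hpow k hk i
    rw [hi]
    simp [zeroExt, hj]
  have hcard := Fintype.card_le_of_injective _ hinj
  simp only [Fintype.card_fun, ZMod.card, Fintype.card_coe, Fintype.card_fin] at hcard
  exact (Nat.pow_le_pow_iff_right one_lt_two).mp hcard

/-- Sending the messages of `R` uncoded. -/
lemma exists_uncoded_generator {n : ℕ} (R M : Finset (Fin n)) (X : Fin n → Finset (Fin n))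
    (hRM : ∀ k ∈ R, k ∈ M) :
    ∃ G : Matrix (Fin n) (Fin R.card) (ZMod 2), (∀ r, r ∉ M → ∀ t, G r t = 0) ∧
      ∀ k ∈ R, ∃ D : (Fin R.card → ZMod 2) → ({j : Fin n // j ∈ X k} → ZMod 2) → ZMod 2,
        ∀ x : Fin n → ZMod 2, D (fun t => ∑ r, x r * G r t) (fun j => x j.val) = x k := by
  refine ⟨fun r t => if r = (R.equivFin.symm t).val then 1 else 0, ?_, ?_⟩
  · intro r hr t
    refine if_neg ?_
    rintro rfl
    exact hr (hRM _ (R.equivFin.symm t).property)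
  · intro k hk
    exact ⟨fun c _ => c (R.equivFin ⟨k, hk⟩), fun x => by simp⟩

theorem stmt_15 (n : ℕ) (hn : 2 ≤ n) (M1 M2 R1 R2 : Finset (Fin n))
    (X : Fin n → Finset (Fin n))
    (hM : M1 ∪ M2 = Finset.univ) (hpart : R1 ∪ R2 = Finset.univ)
    (h12 : Disjoint R1 R2) (hR1ne : R1.Nonempty) (hR2ne : R2.Nonempty)
    (hR1M : ∀ k ∈ R1, k ∈ M1) (hR2M : ∀ k ∈ R2, k ∈ M2)
    (σ : Equiv.Perm (Fin n)) (hcycle : σ.IsCycle) (hsupp : σ.support = Finset.univ)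
    (hX : ∀ k : Fin n, X k = {σ k}) :
    NOptCell n M1 M2 R1 R2 ∅ X = n := by
  have hcard : n = R1.card + R2.card := by
    rw [← Finset.card_union_of_disjoint h12, hpart, Finset.card_univ, Fintype.card_fin]
  have hmem : IsCellIC n M1 M2 R1 R2 ∅ X n := by
    obtain ⟨G1, hG1, hD1⟩ := exists_uncoded_generator R1 M1 X hR1M
    obtain ⟨G2, hG2, hD2⟩ := exists_uncoded_generator R2 M2 X hR2M
    exact ⟨R1.card, R2.card, G1, G2, hcard, hG1, hG2, hD1, hD2, by simp⟩
  refine le_antisymm (Nat.sInf_le hmem) (le_csInf ⟨n, hmem⟩ ?_)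
  rintro N ⟨N1, N2, G1, G2, rfl, -, -, hD1, hD2, -⟩
  obtain ⟨a, ha⟩ := hR1ne
  obtain ⟨b, hb⟩ := hR2ne
  have h1 := card_le_of_cycle_decoding R1 X σ hcycle hsupp hX
    ⟨b, Finset.disjoint_right.mp h12 hb⟩ (fun x t => ∑ r, x r * G1 r t) hD1
  have h2 := card_le_of_cycle_decoding R2 X σ hcycle hsupp hX
    ⟨a, Finset.disjoint_left.mp h12 ha⟩ (fun x t => ∑ r, x r * G2 r t) hD2
  omega
end
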